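/- Let N ≥ 1 and let u1, u2, v1, v2 : ℝ^N → [0,∞) be nonnegative Borel measurable functions vanishing at infinity. Then ∫_{ℝ^N} (u1(x)u2(x) + v1(x)v2(x)) dx ≤ ∫_{ℝ^N} {u1,v1}⋆(x) · {u2,v2}⋆(x) dx, as an inequality of extended nonnegative reals. -/

import Mathlib

open MeasureTheory ENNReal

noncomputable section

/-- Euclidean space `ℝ^N`. -/
abbrev EucN (N : ℕ) : Type := EuclideanSpace ℝ (Fin N)

/-- A function vanishes at infinity if all its strict superlevel sets (of positive level)
have finite Lebesgue measure. -/
def VanishesAtInfinity {N : ℕ} (w : EucN N → ℝ) : Prop :=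
  ∀ t : ℝ, 0 < t → volume {x : EucN N | t < |w x|} < ⊤

/-- `A⋆(u,v;t)`: the open ball centered at the origin whose Lebesgue measure equals
`|{|u| > t}| + |{|v| > t}|` (empty if that sum is `0`). -/
def Astar {N : ℕ} (u v : EucN N → ℝ) (t : ℝ) : Set (EucN N) :=
  {x : EucN N | volume (Metric.ball (0 : EucN N) ‖x‖) <
    volume {y : EucN N | t < |u y|} + volume {y : EucN N | t < |v y|}}

/-- The Shibata rearrangement `{u,v}⋆(x) = ∫₀^∞ χ_{A⋆(u,v;t)}(x) dt`. -/
def shibata {N : ℕ} (u v : EucN N → ℝ) (x : EucN N) : ℝ≥0∞ :=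
  ∫⁻ t in Set.Ioi (0 : ℝ), Set.indicator (Astar u v t) (fun _ => (1 : ℝ≥0∞)) x

/-- Tonelli's theorem for a product of two layer-cake integrals. -/
theorem lintegral_measure_section_mul {α : Type*} [MeasurableSpace α] (μ : Measure α) [SFinite μ]
    (ν : Measure ℝ) [SFinite ν] {P Q : Set (α × ℝ)} (hP : MeasurableSet P)
    (hQ : MeasurableSet Q) :
    ∫⁻ x, ν {s | (x, s) ∈ P} * ν {t | (x, t) ∈ Q} ∂μ =
      ∫⁻ y : ℝ × ℝ, μ {x | (x, y.1) ∈ P ∧ (x, y.2) ∈ Q} ∂(ν.prod ν) := by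
  have hS : MeasurableSet {z : α × ℝ × ℝ | (z.1, z.2.1) ∈ P ∧ (z.1, z.2.2) ∈ Q} :=
    (hP.preimage (by fun_prop : Measurable fun z : α × ℝ × ℝ => (z.1, z.2.1))).inter
      (hQ.preimage (by fun_prop : Measurable fun z : α × ℝ × ℝ => (z.1, z.2.2)))
  have h := Measure.prod_apply_symm (μ := μ) (ν := ν.prod ν) hS
  rw [Measure.prod_apply hS] at h
  refine Eq.trans (lintegral_congr fun x => ?_) h
  rw [← Measure.prod_prod]
  rfl

/-- The centered ball `{x | |B(0, ‖x‖)| < m}` has measure at least `m`. -/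
theorem le_volume_setOf_volume_ball_lt {N : ℕ} (hN : 1 ≤ N) (m : ℝ≥0∞) :
    m ≤ volume {x : EucN N | volume (Metric.ball (0 : EucN N) ‖x‖) < m} := by
  have : Nonempty (Fin N) := ⟨⟨0, hN⟩⟩
  rcases eq_or_ne m ⊤ with rfl | hm
  · have : {x : EucN N | volume (Metric.ball (0 : EucN N) ‖x‖) < ⊤} = Set.univ :=
      Set.eq_univ_of_forall fun x => measure_ball_lt_top
    rw [this, measure_univ_of_isAddLeftInvariant]
  · have hvol : ∀ r : ℝ, 0 ≤ r → volume (Metric.ball (0 : EucN N) r) =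
        ENNReal.ofReal (r ^ N) * volume (Metric.ball (0 : EucN N) 1) := fun r hr => by
      simpa using Measure.addHaar_ball (volume : Measure (EucN N)) 0 hr
    have hc0 : volume (Metric.ball (0 : EucN N) 1) ≠ 0 :=
      (Metric.measure_ball_pos _ _ one_pos).ne'
    have hcT : volume (Metric.ball (0 : EucN N) 1) ≠ ⊤ := measure_ball_lt_top.ne
    have hN0 : N ≠ 0 := by omega
    set c := volume (Metric.ball (0 : EucN N) 1)
    set q : ℝ := (m / c).toReal
    have hq : 0 ≤ q := ENNReal.toReal_nonneg
    set r : ℝ := q ^ ((N : ℝ)⁻¹)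
    have hr : 0 ≤ r := Real.rpow_nonneg hq _
    have hball : volume (Metric.ball (0 : EucN N) r) = m := by
      rw [hvol r hr, Real.rpow_inv_natCast_pow hq hN0,
        ENNReal.ofReal_toReal (ENNReal.div_ne_top hm hc0), ENNReal.div_mul_cancel hc0 hcT]
    calc m = volume (Metric.ball (0 : EucN N) r) := hball.symm
      _ ≤ _ := measure_mono fun x hx => by
        have hx' : ‖x‖ < r := by simpa using hx
        have hpow : ‖x‖ ^ N < r ^ N := pow_lt_pow_left₀ hx' (norm_nonneg x) hN0
        rw [Set.mem_ofPred_eq, ← hball, hvol r hr, hvol _ (norm_nonneg x)]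
        exact (ENNReal.mul_lt_mul_iff_left hc0 hcT).2
          ((ENNReal.ofReal_lt_ofReal_iff_of_nonneg (by positivity)).2 hpow)

theorem measurableSet_Astar_prod {N : ℕ} (u v : EucN N → ℝ) :
    MeasurableSet {p : EucN N × ℝ | p.1 ∈ Astar u v p.2} := by
  have hball : Measurable fun r : ℝ => volume (Metric.ball (0 : EucN N) r) :=
    Monotone.measurable fun _ _ h => measure_mono (Metric.ball_subset_ball h)
  have hdist : ∀ w : EucN N → ℝ, Measurable fun t : ℝ => volume {y : EucN N | t < |w y|} :=
    fun w => Antitone.measurable fun _ _ h => measure_mono fun _ hy => lt_of_le_of_lt h hy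
  exact measurableSet_lt (hball.comp measurable_fst.norm)
    (((hdist u).add (hdist v)).comp measurable_snd)

theorem shibata_eq_volume {N : ℕ} (u v : EucN N → ℝ) (x : EucN N) :
    shibata u v x = volume.restrict (Set.Ioi (0 : ℝ)) {t | x ∈ Astar u v t} := by
  have hS : MeasurableSet {t : ℝ | x ∈ Astar u v t} :=
    measurable_prodMk_left (measurableSet_Astar_prod u v)
  rw [← lintegral_indicator_one hS]
  rfl

theorem ofReal_eq_volume_Ioi_restrict (a : ℝ) :
    ENNReal.ofReal a = volume.restrict (Set.Ioi (0 : ℝ)) {s | s < a} := by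
  have hS : MeasurableSet {s : ℝ | s < a} := measurableSet_Iio
  rw [Measure.restrict_apply hS]
  have : {s : ℝ | s < a} ∩ Set.Ioi 0 = Set.Ioo 0 a := by
    ext s; simp [and_comm]
  rw [this, Real.volume_Ioo, sub_zero]

theorem lintegral_ofReal_mul {N : ℕ} {u w : EucN N → ℝ} (hu : Measurable u) (hw : Measurable w) :
    ∫⁻ x, ENNReal.ofReal (u x) * ENNReal.ofReal (w x) =
      ∫⁻ y : ℝ × ℝ, volume {x | y.1 < u x ∧ y.2 < w x}
        ∂((volume.restrict (Set.Ioi (0 : ℝ))).prod (volume.restrict (Set.Ioi (0 : ℝ)))) := by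
  simp_rw [ofReal_eq_volume_Ioi_restrict]
  exact lintegral_measure_section_mul volume (volume.restrict (Set.Ioi (0 : ℝ)))
    (P := {p | p.2 < u p.1}) (Q := {p | p.2 < w p.1})
    (measurableSet_lt measurable_snd (hu.comp measurable_fst))
    (measurableSet_lt measurable_snd (hw.comp measurable_fst))

theorem volume_add_volume_le_volume_Astar_inter {N : ℕ} (hN : 1 ≤ N) (u1 u2 v1 v2 : EucN N → ℝ)
    (s t : ℝ) :
    volume {x | s < u1 x ∧ t < u2 x} + volume {x | s < v1 x ∧ t < v2 x} ≤
      volume {x | x ∈ Astar u1 v1 s ∧ x ∈ Astar u2 v2 t} := by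
  have h := le_volume_setOf_volume_ball_lt hN
    (min (volume {y : EucN N | s < |u1 y|} + volume {y : EucN N | s < |v1 y|})
      (volume {y : EucN N | t < |u2 y|} + volume {y : EucN N | t < |v2 y|}))
  simp only [lt_min_iff] at h
  refine le_trans (le_min ?_ ?_) h
  · exact add_le_add (measure_mono fun x hx => hx.1.trans_le (le_abs_self _))
      (measure_mono fun x hx => hx.1.trans_le (le_abs_self _))
  · exact add_le_add (measure_mono fun x hx => hx.2.trans_le (le_abs_self _))
      (measure_mono fun x hx => hx.2.trans_le (le_abs_self _))

theorem shibata_product_inequality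
    (N : ℕ) (hN : 1 ≤ N) (u1 u2 v1 v2 : EucN N → ℝ)
    (hu1 : Measurable u1) (hu2 : Measurable u2)
    (hv1 : Measurable v1) (hv2 : Measurable v2)
    (hu1pos : ∀ x, 0 ≤ u1 x) (hu2pos : ∀ x, 0 ≤ u2 x)
    (hv1pos : ∀ x, 0 ≤ v1 x) (hv2pos : ∀ x, 0 ≤ v2 x)
    (hu10 : VanishesAtInfinity u1) (hu20 : VanishesAtInfinity u2)
    (hv10 : VanishesAtInfinity v1) (hv20 : VanishesAtInfinity v2) :
    ∫⁻ x : EucN N, ENNReal.ofReal (u1 x * u2 x + v1 x * v2 x) ≤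
      ∫⁻ x : EucN N, shibata u1 v1 x * shibata u2 v2 x := by
  have hsplit : ∀ x, ENNReal.ofReal (u1 x * u2 x + v1 x * v2 x) =
      ENNReal.ofReal (u1 x) * ENNReal.ofReal (u2 x) +
        ENNReal.ofReal (v1 x) * ENNReal.ofReal (v2 x) := fun x => by
    rw [ENNReal.ofReal_add (mul_nonneg (hu1pos x) (hu2pos x)) (mul_nonneg (hv1pos x) (hv2pos x)),
      ENNReal.ofReal_mul (hu1pos x), ENNReal.ofReal_mul (hv1pos x)]
  have hset : MeasurableSet {z : EucN N × ℝ × ℝ | z.2.1 < u1 z.1 ∧ z.2.2 < u2 z.1} := by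
    measurability
  have hmeas : Measurable fun y : ℝ × ℝ => volume {x | y.1 < u1 x ∧ y.2 < u2 x} :=
    measurable_measure_prodMk_right hset
  simp_rw [hsplit, shibata_eq_volume]
  rw [lintegral_add_left (by fun_prop), lintegral_ofReal_mul hu1 hu2, lintegral_ofReal_mul hv1 hv2,
    ← lintegral_add_left hmeas]
  refine le_trans (lintegral_mono fun y =>
    volume_add_volume_le_volume_Astar_inter hN u1 u2 v1 v2 y.1 y.2) (le_of_eq ?_)
  exact (lintegral_measure_section_mul volume (volume.restrict (Set.Ioi (0 : ℝ)))
    (measurableSet_Astar_prod u1 v1) (measurableSet_Astar_prod u2 v2)).symm
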